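/- Let D be connected and let L be a two-dimensional complex Berwald metric on D satisfying the weak symmetry condition R_{r̄kh̄s}η̄^rη̄^hη^s = R_{r̄sh̄k}η̄^rη^sη̄^h (for k ∈ {1,2}) at every point of D, with A nowhere zero on D. Then the hh̄-Riemann type tensor vanishes identically: R_{r̄jh̄k} = 0 on D for all indices r,j,h,k. -/

import Mathlib

open Complex

noncomputable section

namespace CFinsler

/-- A point of `T'M` in local coordinates: `(z, η) ∈ ℂⁿ × ℂⁿ`. -/
abbrev Pt (n : ℕ) := (Fin n → ℂ) × (Fin n → ℂ)

variable {n : ℕ}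

/-- Wirtinger derivative `∂f/∂z^k`. -/
def dz (f : Pt n → ℂ) (k : Fin n) (p : Pt n) : ℂ :=
  (1 / 2) * (fderiv ℝ f p ((Pi.single k 1 : Fin n → ℂ), 0) -
    Complex.I * fderiv ℝ f p ((Pi.single k Complex.I : Fin n → ℂ), 0))

/-- Wirtinger derivative `∂f/∂z̄^k`. -/
def dzbar (f : Pt n → ℂ) (k : Fin n) (p : Pt n) : ℂ :=
  (1 / 2) * (fderiv ℝ f p ((Pi.single k 1 : Fin n → ℂ), 0) +
    Complex.I * fderiv ℝ f p ((Pi.single k Complex.I : Fin n → ℂ), 0))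

/-- Wirtinger derivative `∂f/∂η^k`. -/
def de (f : Pt n → ℂ) (k : Fin n) (p : Pt n) : ℂ :=
  (1 / 2) * (fderiv ℝ f p (0, (Pi.single k 1 : Fin n → ℂ)) -
    Complex.I * fderiv ℝ f p (0, (Pi.single k Complex.I : Fin n → ℂ)))

/-- Wirtinger derivative `∂f/∂η̄^k`. -/
def debar (f : Pt n → ℂ) (k : Fin n) (p : Pt n) : ℂ :=
  (1 / 2) * (fderiv ℝ f p (0, (Pi.single k 1 : Fin n → ℂ)) +
    Complex.I * fderiv ℝ f p (0, (Pi.single k Complex.I : Fin n → ℂ)))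

/-- The fundamental metric tensor `g_{i j̄} := ∂²L/∂η^i ∂η̄^j`. -/
def gm (L : Pt n → ℂ) (i j : Fin n) : Pt n → ℂ := de (debar L j) i

/-- `L` is an `n`-dimensional complex Finsler metric on `D`. -/
structure IsCFM (n : ℕ) (D : Set (Pt n)) (L : Pt n → ℂ) : Prop where
  openD : IsOpen D
  fiber_ne : ∀ p ∈ D, p.2 ≠ 0
  conic : ∀ p ∈ D, ∀ lam : ℂ, lam ≠ 0 → (p.1, lam • p.2) ∈ D
  smooth : ContDiffOn ℝ (⊤ : ℕ∞) L D
  real_im : ∀ p ∈ D, (L p).im = 0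
  pos : ∀ p ∈ D, 0 < (L p).re
  homog : ∀ p ∈ D, ∀ lam : ℂ, lam ≠ 0 →
    L (p.1, lam • p.2) = ((Complex.normSq lam : ℝ) : ℂ) * L p
  hermitian : ∀ p ∈ D, ∀ i j, (starRingEnd ℂ) (gm L i j p) = gm L j i p
  posdef : ∀ p ∈ D, ∀ v : Fin n → ℂ, v ≠ 0 →
    0 < (∑ i, ∑ j, gm L i j p * v i * (starRingEnd ℂ) (v j)).re

variable (L : Pt n → ℂ)

/-- The metric tensor as a matrix at a point. -/
def gmat (p : Pt n) : Matrix (Fin n) (Fin n) ℂ := fun i j => gm L i j p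

/-- The inverse metric tensor `g^{l̄ i}`. -/
def gi (l i : Fin n) (p : Pt n) : ℂ := (gmat L p)⁻¹ l i

/-- The Chern–Finsler nonlinear connection coefficients
`N^i_k := g^{m̄ i} (∂g_{l m̄}/∂z^k) η^l`. -/
def Nc (i k : Fin n) (p : Pt n) : ℂ :=
  ∑ m, ∑ l, gi L m i p * dz (gm L l m) k p * p.2 l

/-- The horizontal derivation `δ_k := ∂/∂z^k − N^j_k ∂/∂η^j`. -/
def del (f : Pt n → ℂ) (k : Fin n) (p : Pt n) : ℂ :=
  dz f k p - ∑ j, Nc L j k p * de f j p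

/-- The conjugate horizontal derivation `δ_k̄ := ∂/∂z̄^k − N̄^j_k ∂/∂η̄^j`. -/
def delbar (f : Pt n → ℂ) (k : Fin n) (p : Pt n) : ℂ :=
  dzbar f k p - ∑ j, (starRingEnd ℂ) (Nc L j k p) * debar f j p

/-- The horizontal Chern–Finsler connection coefficients `L^i_{jk} := g^{l̄ i} δ_k(g_{j l̄})`. -/
def Lc (i j k : Fin n) (p : Pt n) : ℂ := ∑ l, gi L l i p * del L (gm L j l) k p

/-- The vertical Chern–Finsler connection coefficients `C^i_{jk} := g^{l̄ i} ∂g_{j l̄}/∂η^k`. -/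
def Cc (i j k : Fin n) (p : Pt n) : ℂ := ∑ l, gi L l i p * de (gm L j l) k p

/-- The spray coefficients `G^i := ½ N^i_j η^j`. -/
def Gs (i : Fin n) (p : Pt n) : ℂ := (1 / 2) * ∑ j, Nc L i j p * p.2 j

/-- The canonical horizontal derivation `δ̊_k := ∂/∂z^k − (∂G^j/∂η^k) ∂/∂η^j`. -/
def delc (f : Pt n → ℂ) (k : Fin n) (p : Pt n) : ℂ :=
  dz f k p - ∑ j, de (Gs L j) k p * de f j p

/-- `F := √L`. -/
def Fh (p : Pt n) : ℂ := (Real.sqrt ((L p).re) : ℂ)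

/-- `l^i := η^i / F`. -/
def lup (i : Fin n) (p : Pt n) : ℂ := p.2 i / Fh L p

/-- `l_i := g_{i j̄} η̄^j / F`. -/
def llow (i : Fin n) (p : Pt n) : ℂ :=
  (∑ j, gm L i j p * (starRingEnd ℂ) (p.2 j)) / Fh L p

/-- `√g` where `g := det(g_{i j̄})`. -/
def sg (p : Pt n) : ℂ := (Real.sqrt ((gmat L p).det.re) : ℂ)

/-- The metric is Kähler. -/
def IsKahler (D : Set (Pt n)) : Prop := ∀ p ∈ D, ∀ i j k, Lc L i j k p = Lc L i k j p

/-- The metric is weakly Kähler. -/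
def IsWeaklyKahler (D : Set (Pt n)) : Prop :=
  ∀ p ∈ D, ∀ k, (∑ i, ∑ j, ∑ l, gm L i l p * (Lc L i j k p - Lc L i k j p) *
    p.2 j * (starRingEnd ℂ) (p.2 l)) = 0

/-- The metric is purely Hermitian: `g_{i j̄}` does not depend on the fibre variable. -/
def IsPurelyHermitian (D : Set (Pt n)) : Prop :=
  ∀ p ∈ D, ∀ i j k, de (gm L i j) k p = 0 ∧ debar (gm L i j) k p = 0

/-- The metric is a complex Berwald metric: Kähler with `L^i_{jk}` independent of the
fibre variable. -/
def IsBerwald (D : Set (Pt n)) : Prop :=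
  IsKahler L D ∧ ∀ p ∈ D, ∀ i j k l, de (Lc L i j k) l p = 0 ∧ debar (Lc L i j k) l p = 0

/-- The metric is a complex Landsberg metric: the Berwald and Rund connections coincide. -/
def IsLandsberg (D : Set (Pt n)) : Prop :=
  ∀ p ∈ D, ∀ i j k, de (de (Gs L i) k) j p =
    (1 / 2) * ∑ l, gi L l i p * (delc L (gm L j l) k p + delc L (gm L k l) j p)

/-- `m^i` of the local complex Berwald frame: `m¹ = −l₂/√g`, `m² = l₁/√g`. -/
def mup (L : Pt 2 → ℂ) (i : Fin 2) (p : Pt 2) : ℂ :=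
  if i = 0 then -(llow L 1 p) / sg L p else llow L 0 p / sg L p

/-- `m_i := g_{i j̄} m̄^j`. -/
def mlow (L : Pt 2 → ℂ) (i : Fin 2) (p : Pt 2) : ℂ :=
  ∑ j, gm L i j p * (starRingEnd ℂ) (mup L j p)

/-- `A := m^j m^k l_h C^h_{kj}`. -/
def sA (L : Pt 2 → ℂ) (p : Pt 2) : ℂ :=
  ∑ j, ∑ k, ∑ h, mup L j p * mup L k p * llow L h p * Cc L h k j p

/-- `B := m_h m^k m^j C^h_{jk}`. -/
def sB (L : Pt 2 → ℂ) (p : Pt 2) : ℂ :=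
  ∑ j, ∑ k, ∑ h, mlow L h p * mup L k p * mup L j p * Cc L h j k p

/-- `J := l^j l^k l_i L^i_{jk}`. -/
def sJ (L : Pt 2 → ℂ) (p : Pt 2) : ℂ :=
  ∑ j, ∑ k, ∑ i, lup L j p * lup L k p * llow L i p * Lc L i j k p

/-- `U := m^j l^k l_i L^i_{jk}`. -/
def sU (L : Pt 2 → ℂ) (p : Pt 2) : ℂ :=
  ∑ j, ∑ k, ∑ i, mup L j p * lup L k p * llow L i p * Lc L i j k p

/-- `V := l^j m^k l_i L^i_{jk}`. -/
def sV (L : Pt 2 → ℂ) (p : Pt 2) : ℂ :=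
  ∑ j, ∑ k, ∑ i, lup L j p * mup L k p * llow L i p * Lc L i j k p

/-- `X := m^j m^k l_i L^i_{jk}`. -/
def sX (L : Pt 2 → ℂ) (p : Pt 2) : ℂ :=
  ∑ j, ∑ k, ∑ i, mup L j p * mup L k p * llow L i p * Lc L i j k p

/-- `O := l^j l^k m_i L^i_{jk}`. -/
def sO (L : Pt 2 → ℂ) (p : Pt 2) : ℂ :=
  ∑ j, ∑ k, ∑ i, lup L j p * lup L k p * mlow L i p * Lc L i j k p

/-- `Y := m^j l^k m_i L^i_{jk}`. -/
def sY (L : Pt 2 → ℂ) (p : Pt 2) : ℂ :=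
  ∑ j, ∑ k, ∑ i, mup L j p * lup L k p * mlow L i p * Lc L i j k p

/-- `E := l^j m^k m_i L^i_{jk}`. -/
def sE (L : Pt 2 → ℂ) (p : Pt 2) : ℂ :=
  ∑ j, ∑ k, ∑ i, lup L j p * mup L k p * mlow L i p * Lc L i j k p

/-- `H := m^j m^k m_i L^i_{jk}`. -/
def sH (L : Pt 2 → ℂ) (p : Pt 2) : ℂ :=
  ∑ j, ∑ k, ∑ i, mup L j p * mup L k p * mlow L i p * Lc L i j k p

/-- The vertical curvature invariant `I := −(∂B/∂η̄^s) m̄^s − B B̄/2`. -/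
def vI (L : Pt 2 → ℂ) (p : Pt 2) : ℂ :=
  -(∑ s, debar (sB L) s p * (starRingEnd ℂ) (mup L s p)) -
    sB L p * (starRingEnd ℂ) (sB L p) / 2

/-- The `v v̄`-Riemann type tensor `S_{r̄ j h̄ k} := −g_{i r̄} ∂C^i_{jk}/∂η̄^h`. -/
def Sv (L : Pt 2 → ℂ) (r j h k : Fin 2) (p : Pt 2) : ℂ :=
  -∑ i, gm L i r p * debar (Cc L i j k) h p

/-- The `h h̄`-Riemann type tensor
`R_{r̄ j h̄ k} := g_{i r̄} (−δ_h̄(L^i_{jk}) − δ_h̄(N^l_k) C^i_{jl})`. -/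
def Rh (L : Pt 2 → ℂ) (r j h k : Fin 2) (p : Pt 2) : ℂ :=
  ∑ i, gm L i r p *
    (-(delbar L (Lc L i j k) h p) - ∑ l, delbar L (Nc L l k) h p * Cc L i j l p)

/-- The horizontal curvature invariant `K := −(1/F) δ_k̄(J) η̄^k`. -/
def hK (L : Pt 2 → ℂ) (p : Pt 2) : ℂ :=
  -(1 / Fh L p) * ∑ k, delbar L (sJ L) k p * (starRingEnd ℂ) (p.2 k)

/-- The horizontal curvature invariant
`W := −δ_s̄(H) m̄^s − ½ H (V̄+H̄) − B F δ_s̄(E) m̄^s`. -/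
def hW (L : Pt 2 → ℂ) (p : Pt 2) : ℂ :=
  -(∑ s, delbar L (sH L) s p * (starRingEnd ℂ) (mup L s p)) -
    (1 / 2) * sH L p * ((starRingEnd ℂ) (sV L p) + (starRingEnd ℂ) (sH L p)) -
    sB L p * Fh L p * ∑ s, delbar L (sE L) s p * (starRingEnd ℂ) (mup L s p)

/-- The weak symmetry condition `R_{0̄ k 0̄ 0} = R_{0̄ 0 0̄ k}`, i.e.
`R_{r̄ k h̄ s} η̄^r η̄^h η^s = R_{r̄ s h̄ k} η̄^r η^s η̄^h`. -/
def WeakSym (L : Pt 2 → ℂ) (D : Set (Pt 2)) : Prop :=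
  ∀ p ∈ D, ∀ k,
    (∑ r, ∑ h, ∑ s, Rh L r k h s p * (starRingEnd ℂ) (p.2 r) *
      (starRingEnd ℂ) (p.2 h) * p.2 s) =
    ∑ r, ∑ s, ∑ h, Rh L r s h k p * (starRingEnd ℂ) (p.2 r) * p.2 s *
      (starRingEnd ℂ) (p.2 h)


/-- First-order constant-coefficient operators of Wirtinger shape. -/
def IsWirt (δ : (Pt n → ℂ) → Pt n → ℂ) : Prop :=
  ∃ (c : ℂ) (v w : Pt n), ∀ f p, δ f p = (1 / 2) * (fderiv ℝ f p v + c * fderiv ℝ f p w)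

theorem isWirt_dz (k : Fin n) : IsWirt (fun f => dz f k) :=
  ⟨-I, (Pi.single k 1, 0), (Pi.single k I, 0), fun f p => by
    simp only [dz, neg_mul, sub_eq_add_neg]⟩

theorem isWirt_dzbar (k : Fin n) : IsWirt (fun f => dzbar f k) :=
  ⟨I, _, _, fun _ _ => rfl⟩

theorem isWirt_de (k : Fin n) : IsWirt (fun f => de f k) :=
  ⟨-I, (0, Pi.single k 1), (0, Pi.single k I), fun f p => by
    simp only [de, neg_mul, sub_eq_add_neg]⟩

theorem isWirt_debar (k : Fin n) : IsWirt (fun f => debar f k) :=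
  ⟨I, _, _, fun _ _ => rfl⟩

namespace IsWirt

variable {δ δ' : (Pt n → ℂ) → Pt n → ℂ} {D : Set (Pt n)} {f g : Pt n → ℂ} {p : Pt n}

theorem congr (hδ : IsWirt δ) (hD : IsOpen D) (hp : p ∈ D) (h : ∀ q ∈ D, f q = g q) :
    δ f p = δ g p := by
  obtain ⟨c, v, w, hδ⟩ := hδ
  have : f =ᶠ[nhds p] g := Filter.eventually_of_mem (hD.mem_nhds hp) h
  rw [hδ, hδ, this.fderiv_eq]

theorem const (hδ : IsWirt δ) (a : ℂ) : δ (fun _ => a) p = 0 := by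
  obtain ⟨c, v, w, hδ⟩ := hδ
  simp [hδ]

theorem eq_zero (hδ : IsWirt δ) (hD : IsOpen D) (hp : p ∈ D) (h : ∀ q ∈ D, f q = 0) :
    δ f p = 0 :=
  (hδ.congr hD hp h).trans (hδ.const 0)

theorem add (hδ : IsWirt δ) (hf : DifferentiableAt ℝ f p) (hg : DifferentiableAt ℝ g p) :
    δ (fun q => f q + g q) p = δ f p + δ g p := by
  obtain ⟨c, v, w, hδ⟩ := hδ
  simp only [hδ, fderiv_fun_add hf hg, _root_.add_apply]
  ring

theorem sub (hδ : IsWirt δ) (hf : DifferentiableAt ℝ f p) (hg : DifferentiableAt ℝ g p) :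
    δ (fun q => f q - g q) p = δ f p - δ g p := by
  obtain ⟨c, v, w, hδ⟩ := hδ
  simp only [hδ, fderiv_fun_sub hf hg, _root_.sub_apply]
  ring

theorem mul (hδ : IsWirt δ) (hf : DifferentiableAt ℝ f p) (hg : DifferentiableAt ℝ g p) :
    δ (fun q => f q * g q) p = δ f p * g p + f p * δ g p := by
  obtain ⟨c, v, w, hδ⟩ := hδ
  simp only [hδ, fderiv_fun_mul hf hg, _root_.add_apply,
    _root_.smul_apply, smul_eq_mul]
  ring

theorem contDiffOn (hδ : IsWirt δ) (hD : IsOpen D) (hf : ContDiffOn ℝ (⊤ : ℕ∞) f D) :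
    ContDiffOn ℝ (⊤ : ℕ∞) (δ f) D := by
  obtain ⟨c, v, w, hδ⟩ := hδ
  have h1 : ContDiffOn ℝ (⊤ : ℕ∞) (fderiv ℝ f) D := hf.fderiv_of_isOpen hD (by simp)
  have h2 : δ f = fun p => (1 / 2) * (fderiv ℝ f p v + c * fderiv ℝ f p w) := funext (hδ f)
  rw [h2]
  exact contDiffOn_const.mul ((h1.clm_apply contDiffOn_const).add
    (contDiffOn_const.mul (h1.clm_apply contDiffOn_const)))

theorem comm (hδ : IsWirt δ) (hδ' : IsWirt δ') (hD : IsOpen D) (hp : p ∈ D)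
    (hf : ContDiffOn ℝ (⊤ : ℕ∞) f D) : δ (δ' f) p = δ' (δ f) p := by
  have h1 : ContDiffOn ℝ (⊤ : ℕ∞) (fderiv ℝ f) D := hf.fderiv_of_isOpen hD (by simp)
  have h2 : DifferentiableAt ℝ (fderiv ℝ f) p :=
    (h1.contDiffAt (hD.mem_nhds hp)).differentiableAt (by simp)
  have hs : IsSymmSndFDerivAt ℝ f p :=
    (hf.contDiffAt (hD.mem_nhds hp)).isSymmSndFDerivAt
      (by rw [minSmoothness_of_isRCLikeNormedField]; exact WithTop.coe_le_coe.2 le_top)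
  have key : ∀ v w : Pt n, fderiv ℝ (fun q => fderiv ℝ f q v) p w = fderiv ℝ (fderiv ℝ f) p w v := by
    intro v w
    rw [fderiv_clm_apply h2 (differentiableAt_const v)]
    simp
  have key2 : ∀ (c : ℂ) (v w u : Pt n),
      fderiv ℝ (fun q => (1 / 2) * (fderiv ℝ f q v + c * fderiv ℝ f q w)) p u
        = (1 / 2) * (fderiv ℝ (fderiv ℝ f) p u v + c * fderiv ℝ (fderiv ℝ f) p u w) := by
    intro c v w u
    have hd : ∀ v, DifferentiableAt ℝ (fun q => fderiv ℝ f q v) p := fun v =>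
      h2.clm_apply (differentiableAt_const v)
    have e := ((hd v).hasFDerivAt.fun_add ((hd w).hasFDerivAt.const_mul c)).const_mul (1 / 2 : ℂ)
    rw [e.fderiv]
    simp [key, mul_add]
  obtain ⟨c, v, w, hδ⟩ := hδ
  obtain ⟨c', v', w', hδ'⟩ := hδ'
  rw [hδ, hδ', funext (hδ f), funext (hδ' f)]
  simp only [key2]
  rw [hs v v', hs v w', hs w v', hs w w']
  ring

end IsWirt

open scoped ComplexConjugate

section coordinates

variable {f : Pt n → ℂ} {p : Pt n} {k i : Fin n}

theorem fderiv_conj_apply (f : Pt n → ℂ) (p v : Pt n) :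
    fderiv ℝ (fun q => conj (f q)) p v = conj (fderiv ℝ f p v) := by
  have := Complex.conjCLE.comp_fderiv (f := f) (x := p)
  have h2 := congrArg (fun T => T v) this
  simpa [Function.comp_def] using h2

theorem dz_conj : dz (fun q => conj (f q)) k p = conj (dzbar f k p) := by
  simp [dz, dzbar, map_ofNat, fderiv_conj_apply, sub_eq_add_neg]

theorem dzbar_conj : dzbar (fun q => conj (f q)) k p = conj (dz f k p) := by
  simp [dz, dzbar, map_ofNat, fderiv_conj_apply]

theorem de_conj : de (fun q => conj (f q)) k p = conj (debar f k p) := by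
  simp [de, debar, map_ofNat, fderiv_conj_apply, sub_eq_add_neg]

theorem debar_conj : debar (fun q => conj (f q)) k p = conj (de f k p) := by
  simp [de, debar, map_ofNat, fderiv_conj_apply]

theorem fderiv_snd_apply (p v : Pt n) :
    fderiv ℝ (fun q : Pt n => q.2 i) p v = v.2 i := by
  have : HasFDerivAt (fun q : Pt n => q.2 i)
      ((ContinuousLinearMap.proj (R := ℝ) i).comp
        (ContinuousLinearMap.snd ℝ (Fin n → ℂ) (Fin n → ℂ))) p :=
    ((ContinuousLinearMap.proj (R := ℝ) i).comp
      (ContinuousLinearMap.snd ℝ (Fin n → ℂ) (Fin n → ℂ))).hasFDerivAt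
  rw [this.fderiv]
  simp

theorem de_snd : de (fun q : Pt n => q.2 i) k p = if i = k then 1 else 0 := by
  simp only [de, fderiv_snd_apply, Pi.single_apply]
  split_ifs <;> norm_num

theorem debar_snd : debar (fun q : Pt n => q.2 i) k p = 0 := by
  simp only [debar, fderiv_snd_apply, Pi.single_apply]
  split_ifs <;> norm_num

theorem dz_snd : dz (fun q : Pt n => q.2 i) k p = 0 := by
  simp [dz, fderiv_snd_apply]

theorem dzbar_snd : dzbar (fun q : Pt n => q.2 i) k p = 0 := by
  simp [dzbar, fderiv_snd_apply]

theorem contDiff_snd_apply : ContDiff ℝ (⊤ : ℕ∞) (fun q : Pt n => q.2 i) := by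
  fun_prop

theorem contDiffOn_conj {D : Set (Pt n)} (hf : ContDiffOn ℝ (⊤ : ℕ∞) f D) :
    ContDiffOn ℝ (⊤ : ℕ∞) (fun q => conj (f q)) D :=
  Complex.conjCLE.contDiff.comp_contDiffOn hf

end coordinates

theorem differentiableAt_of_contDiffOn {D : Set (Pt n)} {f : Pt n → ℂ} {p : Pt n} (hD : IsOpen D)
    (hp : p ∈ D) (hf : ContDiffOn ℝ (⊤ : ℕ∞) f D) : DifferentiableAt ℝ f p :=
  (hf.contDiffAt (hD.mem_nhds hp)).differentiableAt (by simp)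

theorem IsWirt.sum {ι : Type*} {δ : (Pt n → ℂ) → Pt n → ℂ} {p : Pt n} (hδ : IsWirt δ)
    (s : Finset ι) {f : ι → Pt n → ℂ} (hf : ∀ i ∈ s, DifferentiableAt ℝ (f i) p) :
    δ (fun q => ∑ i ∈ s, f i q) p = ∑ i ∈ s, δ (f i) p := by
  classical
  induction s using Finset.induction_on with
  | empty => simpa using hδ.const (p := p) 0
  | insert a s ha ih =>
    simp only [Finset.sum_insert ha]
    rw [hδ.add (hf a (Finset.mem_insert_self a s))
      (DifferentiableAt.fun_sum fun i hi => hf i (Finset.mem_insert_of_mem hi)),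
      ih fun i hi => hf i (Finset.mem_insert_of_mem hi)]

/-- Smooth functions on `D` annihilated by `δ`. -/
structure Ker (δ : (Pt n → ℂ) → Pt n → ℂ) (D : Set (Pt n)) (f : Pt n → ℂ) : Prop where
  smooth : ContDiffOn ℝ (⊤ : ℕ∞) f D
  eq_zero : ∀ p ∈ D, δ f p = 0

namespace Ker

variable {δ : (Pt n → ℂ) → Pt n → ℂ} {D : Set (Pt n)} {f g a b c d x : Pt n → ℂ} {p : Pt n}

theorem add (hδ : IsWirt δ) (hD : IsOpen D) (hf : Ker δ D f) (hg : Ker δ D g) :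
    Ker δ D (fun q => f q + g q) where
  smooth := hf.smooth.add hg.smooth
  eq_zero p hp := by
    rw [hδ.add (differentiableAt_of_contDiffOn hD hp hf.smooth)
      (differentiableAt_of_contDiffOn hD hp hg.smooth), hf.eq_zero p hp, hg.eq_zero p hp, add_zero]

theorem mul (hδ : IsWirt δ) (hD : IsOpen D) (hf : Ker δ D f) (hg : Ker δ D g) :
    Ker δ D (fun q => f q * g q) where
  smooth := hf.smooth.mul hg.smooth
  eq_zero p hp := by
    rw [hδ.mul (differentiableAt_of_contDiffOn hD hp hf.smooth)
      (differentiableAt_of_contDiffOn hD hp hg.smooth), hf.eq_zero p hp, hg.eq_zero p hp]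
    ring

theorem const (hδ : IsWirt δ) (z : ℂ) : Ker δ D (fun _ => z) where
  smooth := contDiffOn_const
  eq_zero _ _ := hδ.const z

theorem sub (hδ : IsWirt δ) (hD : IsOpen D) (hf : Ker δ D f) (hg : Ker δ D g) :
    Ker δ D (fun q => f q - g q) where
  smooth := hf.smooth.sub hg.smooth
  eq_zero p hp := by
    rw [hδ.sub (differentiableAt_of_contDiffOn hD hp hf.smooth)
      (differentiableAt_of_contDiffOn hD hp hg.smooth), hf.eq_zero p hp, hg.eq_zero p hp, sub_zero]

theorem eq_zero_of_affine (hδ : IsWirt δ) (hD : IsOpen D) (hx : ContDiffOn ℝ (⊤ : ℕ∞) x D)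
    (hx1 : ∀ p ∈ D, δ x p = 1) (ha : Ker δ D a) (hb : Ker δ D b)
    (h : ∀ p ∈ D, a p * x p + b p = 0) : ∀ p ∈ D, a p = 0 ∧ b p = 0 := by
  intro p hp
  have d {f} (hf : ContDiffOn ℝ (⊤ : ℕ∞) f D) := differentiableAt_of_contDiffOn hD hp hf
  have h1 := hδ.eq_zero hD hp h
  rw [hδ.add (d (ha.smooth.mul hx)) (d hb.smooth), hδ.mul (d ha.smooth) (d hx), ha.eq_zero p hp,
    hb.eq_zero p hp, hx1 p hp] at h1
  have h2 : a p = 0 := by linear_combination h1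
  exact ⟨h2, by simpa [h2] using h p hp⟩

theorem eq_zero_of_quadratic (hδ : IsWirt δ) (hD : IsOpen D) (hx : ContDiffOn ℝ (⊤ : ℕ∞) x D)
    (hx1 : ∀ p ∈ D, δ x p = 1) (ha : Ker δ D a) (hb : Ker δ D b) (hc : Ker δ D c)
    (h : ∀ p ∈ D, (a p * x p + b p) * x p + c p = 0) :
    ∀ p ∈ D, a p = 0 ∧ b p = 0 ∧ c p = 0 := by
  have h3 : ∀ p ∈ D, 2 * a p * x p + b p = 0 := by
    intro p hp
    have d {f} (hf : ContDiffOn ℝ (⊤ : ℕ∞) f D) := differentiableAt_of_contDiffOn hD hp hf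
    have h1 := hδ.eq_zero hD hp h
    rw [hδ.add (d (((ha.smooth.mul hx).add hb.smooth).mul hx)) (d hc.smooth),
      hδ.mul (d ((ha.smooth.mul hx).add hb.smooth)) (d hx),
      hδ.add (d (ha.smooth.mul hx)) (d hb.smooth), hδ.mul (d ha.smooth) (d hx), ha.eq_zero p hp,
      hb.eq_zero p hp, hc.eq_zero p hp, hx1 p hp] at h1
    linear_combination h1
  intro p hp
  obtain ⟨h4, h5⟩ := eq_zero_of_affine hδ hD hx hx1 ((const hδ 2).mul hδ hD ha) hb h3 p hp
  have h6 : a p = 0 := by simpa using h4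
  exact ⟨h6, h5, by simpa [h6, h5] using h p hp⟩

theorem eq_zero_of_cubic (hδ : IsWirt δ) (hD : IsOpen D) (hx : ContDiffOn ℝ (⊤ : ℕ∞) x D)
    (hx1 : ∀ p ∈ D, δ x p = 1) (ha : Ker δ D a) (hb : Ker δ D b) (hc : Ker δ D c)
    (hd : Ker δ D d) (h : ∀ p ∈ D, ((a p * x p + b p) * x p + c p) * x p + d p = 0) :
    ∀ p ∈ D, a p = 0 ∧ b p = 0 ∧ c p = 0 ∧ d p = 0 := by
  have h3 : ∀ p ∈ D, (3 * a p * x p + 2 * b p) * x p + c p = 0 := by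
    intro p hp
    have d' {f} (hf : ContDiffOn ℝ (⊤ : ℕ∞) f D) := differentiableAt_of_contDiffOn hD hp hf
    have s1 := (ha.smooth.mul hx).add hb.smooth
    have s2 := (s1.mul hx).add hc.smooth
    have h1 := hδ.eq_zero hD hp h
    rw [hδ.add (d' (s2.mul hx)) (d' hd.smooth), hδ.mul (d' s2) (d' hx),
      hδ.add (d' (s1.mul hx)) (d' hc.smooth), hδ.mul (d' s1) (d' hx),
      hδ.add (d' (ha.smooth.mul hx)) (d' hb.smooth), hδ.mul (d' ha.smooth) (d' hx),
      ha.eq_zero p hp, hb.eq_zero p hp, hc.eq_zero p hp, hd.eq_zero p hp, hx1 p hp] at h1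
    linear_combination h1
  intro p hp
  obtain ⟨h4, h5, h6⟩ := eq_zero_of_quadratic hδ hD hx hx1 ((const hδ 3).mul hδ hD ha)
    ((const hδ 2).mul hδ hD hb) hc h3 p hp
  have h7 : a p = 0 := by simpa using h4
  have h8 : b p = 0 := by simpa using h5
  exact ⟨h7, h8, h6, by simpa [h6, h7, h8] using h p hp⟩

end Ker

theorem fderiv_vertical_apply (f : Pt n → ℂ) (p : Pt n) (v : Fin n → ℂ) :
    fderiv ℝ f p (0, v) = ∑ k, (v k * de f k p + conj (v k) * debar f k p) := by
  have hv : ((0, v) : Pt n) = ∑ k, ((v k).re • ((0, Pi.single k 1) : Pt n)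
      + (v k).im • ((0, Pi.single k I) : Pt n)) := by
    refine Prod.ext ?_ ?_
    · simp [Prod.fst_sum]
    · funext i
      simp [Prod.snd_sum, Finset.sum_apply, Pi.single_apply, Finset.sum_add_distrib]
  rw [hv, map_sum]
  refine Finset.sum_congr rfl fun k _ => ?_
  rw [map_add, map_smul, map_smul, de, debar]
  set a := fderiv ℝ f p (0, Pi.single k 1)
  set b := fderiv ℝ f p (0, Pi.single k I)
  simp only [Complex.real_smul]
  have e1 : v k = (v k).re + (v k).im * I := (Complex.re_add_im (v k)).symm
  have e2 : conj (v k) = (v k).re - (v k).im * I := by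
    apply Complex.ext <;> simp
  rw [e2]
  conv_rhs => rw [e1]
  simp only [Complex.add_re, Complex.ofReal_re, Complex.mul_re, Complex.I_re, Complex.ofReal_im,
    Complex.I_im, Complex.add_im, Complex.mul_im, mul_zero, mul_one, zero_add, add_zero, sub_zero]
  linear_combination ((v k).im * b) * I_sq

namespace IsCFM

section general

variable {D : Set (Pt n)} {L : Pt n → ℂ} {p : Pt n}

theorem differentiableAt (hL : IsCFM n D L) (hp : p ∈ D) {f : Pt n → ℂ}
    (hf : ContDiffOn ℝ (⊤ : ℕ∞) f D) : DifferentiableAt ℝ f p :=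
  differentiableAt_of_contDiffOn hL.openD hp hf

theorem smooth_de (hL : IsCFM n D L) (i : Fin n) : ContDiffOn ℝ (⊤ : ℕ∞) (de L i) D :=
  (isWirt_de i).contDiffOn hL.openD hL.smooth

theorem smooth_debar (hL : IsCFM n D L) (i : Fin n) : ContDiffOn ℝ (⊤ : ℕ∞) (debar L i) D :=
  (isWirt_debar i).contDiffOn hL.openD hL.smooth

theorem smooth_gm (hL : IsCFM n D L) (i j : Fin n) : ContDiffOn ℝ (⊤ : ℕ∞) (gm L i j) D :=
  (isWirt_de i).contDiffOn hL.openD (hL.smooth_debar j)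

theorem conj_eq (hL : IsCFM n D L) (hp : p ∈ D) : conj (L p) = L p :=
  Complex.conj_eq_iff_im.2 (hL.real_im p hp)

theorem ne_zero (hL : IsCFM n D L) (hp : p ∈ D) : L p ≠ 0 := by
  intro h
  have := hL.pos p hp
  simp [h] at this

theorem fderiv_smul (hL : IsCFM n D L) (hp : p ∈ D) (c : ℂ) :
    fderiv ℝ L p (0, c • p.2) = 2 * (c.re : ℂ) * L p := by
  have h1 : HasDerivAt (fun t : ℝ => ((p.1, (1 + (t : ℂ) * c) • p.2) : Pt n)) (0, c • p.2) 0 := by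
    refine HasDerivAt.prodMk (hasDerivAt_const _ _) ?_
    have : HasDerivAt (fun t : ℝ => 1 + (t : ℂ) * c) c 0 := by
      simpa using ((Complex.ofRealCLM.hasDerivAt (x := (0 : ℝ))).mul_const c).const_add 1
    exact this.smul_const p.2
  have h0 : ((p.1, (1 + ((0 : ℝ) : ℂ) * c) • p.2) : Pt n) = p := by simp
  have h2 : HasFDerivAt L (fderiv ℝ L p) ((p.1, (1 + ((0 : ℝ) : ℂ) * c) • p.2) : Pt n) := by
    rw [h0]
    exact (hL.differentiableAt hp hL.smooth).hasFDerivAt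
  have h3 := h2.comp_hasDerivAt (0 : ℝ) h1
  have h4 : HasDerivAt (fun t : ℝ => ((1 + 2 * c.re * t + Complex.normSq c * t ^ 2 : ℝ) : ℂ) * L p)
      (2 * (c.re : ℂ) * L p) 0 := by
    have : HasDerivAt (fun t : ℝ => 1 + 2 * c.re * t + Complex.normSq c * t ^ 2) (2 * c.re) 0 := by
      have e1 := ((hasDerivAt_id (0 : ℝ)).const_mul (2 * c.re)).const_add 1
      have e2 := ((hasDerivAt_id (0 : ℝ)).pow 2).const_mul (Complex.normSq c)
      simpa using e1.fun_add e2
    simpa using this.ofReal_comp.mul_const (L p)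
  have h5 : (L ∘ fun t : ℝ => ((p.1, (1 + (t : ℂ) * c) • p.2) : Pt n)) =ᶠ[nhds 0]
      fun t : ℝ => ((1 + 2 * c.re * t + Complex.normSq c * t ^ 2 : ℝ) : ℂ) * L p := by
    have hne : ∀ᶠ t : ℝ in nhds 0, (1 + (t : ℂ) * c) ≠ 0 := by
      have hc : Continuous fun t : ℝ => 1 + (t : ℂ) * c := by fun_prop
      exact hc.continuousAt.eventually_ne (by simp)
    filter_upwards [hne] with t ht
    simp only [Function.comp_apply]
    rw [hL.homog p hp _ ht]
    congr 2
    simp [Complex.normSq_apply]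
    ring
  exact h3.unique (h4.congr_of_eventuallyEq h5)

theorem euler (hL : IsCFM n D L) (hp : p ∈ D) : ∑ i, p.2 i * de L i p = L p := by
  have h1 := hL.fderiv_smul hp 1
  have h2 := hL.fderiv_smul hp I
  rw [fderiv_vertical_apply, Finset.sum_add_distrib] at h1 h2
  simp only [Pi.smul_apply, smul_eq_mul, one_mul, Complex.one_re, Complex.I_re, map_mul,
    Complex.conj_I, mul_assoc, neg_mul, Finset.sum_neg_distrib, ← Finset.mul_sum] at h1 h2
  push_cast at h1 h2
  linear_combination (1 / 2) * h1 - (I / 2) * h2 +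
    (1 / 2) * (∑ i, p.2 i * de L i p - ∑ i, conj (p.2 i) * debar L i p) * I_sq

theorem conj_de (hL : IsCFM n D L) (hp : p ∈ D) (i : Fin n) :
    conj (de L i p) = debar L i p := by
  rw [← debar_conj]
  exact (isWirt_debar i).congr hL.openD hp fun q hq => hL.conj_eq hq

theorem conj_dz (hL : IsCFM n D L) (hp : p ∈ D) (i : Fin n) :
    conj (dz L i p) = dzbar L i p := by
  rw [← dzbar_conj]
  exact (isWirt_dzbar i).congr hL.openD hp fun q hq => hL.conj_eq hq

theorem euler_conj (hL : IsCFM n D L) (hp : p ∈ D) : ∑ i, conj (p.2 i) * debar L i p = L p := by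
  have h := congrArg conj (hL.euler hp)
  rw [hL.conj_eq hp, map_sum] at h
  simpa only [map_mul, hL.conj_de hp] using h

/-- The mixed fibre derivatives satisfy `g_{i j̄} η^i = ∂L/∂η̄^j`. -/
theorem sum_gm_mul (hL : IsCFM n D L) (hp : p ∈ D) (j : Fin n) :
    ∑ i, gm L i j p * p.2 i = debar L j p := by
  have h := (isWirt_debar j).congr hL.openD hp fun q hq => hL.euler hq
  have hs : ∀ i ∈ Finset.univ, DifferentiableAt ℝ (fun q : Pt n => q.2 i * de L i q) p :=
    fun i _ => hL.differentiableAt hp (contDiff_snd_apply.contDiffOn.mul (hL.smooth_de i))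
  rw [(isWirt_debar j).sum _ hs] at h
  rw [← h]
  refine Finset.sum_congr rfl fun i _ => ?_
  rw [(isWirt_debar j).mul (hL.differentiableAt hp contDiff_snd_apply.contDiffOn)
    (hL.differentiableAt hp (hL.smooth_de i)), debar_snd, gm,
    (isWirt_debar j).comm (isWirt_de i) hL.openD hp hL.smooth]
  ring

/-- `g_{i j̄} η̄^j = ∂L/∂η^i`. -/
theorem sum_gm_mul_conj (hL : IsCFM n D L) (hp : p ∈ D) (i : Fin n) :
    ∑ j, gm L i j p * conj (p.2 j) = de L i p := by
  have h := congrArg conj (hL.sum_gm_mul hp i)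
  rw [← hL.conj_de hp, Complex.conj_conj, map_sum] at h
  rw [← h]
  exact Finset.sum_congr rfl fun j _ => by rw [map_mul, hL.hermitian p hp]

theorem sum_de_de_mul (hL : IsCFM n D L) (hp : p ∈ D) (j : Fin n) :
    ∑ i, de (de L i) j p * p.2 i = 0 := by
  have h := (isWirt_de j).congr hL.openD hp fun q hq => hL.euler hq
  have hs : ∀ i ∈ Finset.univ, DifferentiableAt ℝ (fun q : Pt n => q.2 i * de L i q) p :=
    fun i _ => hL.differentiableAt hp (contDiff_snd_apply.contDiffOn.mul (hL.smooth_de i))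
  rw [(isWirt_de j).sum _ hs] at h
  have h2 : ∀ i ∈ Finset.univ, de (fun q : Pt n => q.2 i * de L i q) j p =
      (if i = j then de L i p else 0) + de (de L i) j p * p.2 i := by
    intro i _
    rw [(isWirt_de j).mul (hL.differentiableAt hp contDiff_snd_apply.contDiffOn)
      (hL.differentiableAt hp (hL.smooth_de i)), de_snd]
    split_ifs <;> ring
  rw [Finset.sum_congr rfl h2, Finset.sum_add_distrib, Finset.sum_ite_eq' Finset.univ j] at h
  simpa using h

/-- The metric tensor is homogeneous of degree zero, contracted on its first index. -/
theorem sum_de_gm_mul (hL : IsCFM n D L) (hp : p ∈ D) (l m : Fin n) :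
    ∑ j, de (gm L j l) m p * p.2 j = 0 := by
  have h := (isWirt_de m).congr hL.openD hp fun q hq => hL.sum_gm_mul hq l
  have hs : ∀ i ∈ Finset.univ, DifferentiableAt ℝ (fun q : Pt n => gm L i l q * q.2 i) p :=
    fun i _ => hL.differentiableAt hp ((hL.smooth_gm i l).mul contDiff_snd_apply.contDiffOn)
  rw [(isWirt_de m).sum _ hs] at h
  have h2 : ∀ i ∈ Finset.univ, de (fun q : Pt n => gm L i l q * q.2 i) m p =
      de (gm L i l) m p * p.2 i + (if i = m then gm L i l p else 0) := by
    intro i _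
    rw [(isWirt_de m).mul (hL.differentiableAt hp (hL.smooth_gm i l))
      (hL.differentiableAt hp contDiff_snd_apply.contDiffOn), de_snd]
    split_ifs <;> ring
  rw [Finset.sum_congr rfl h2, Finset.sum_add_distrib, Finset.sum_ite_eq' Finset.univ m] at h
  simpa [gm] using h

theorem sum_de_gm_mul_conj (hL : IsCFM n D L) (hp : p ∈ D) (i l : Fin n) :
    ∑ j, de (gm L i j) l p * conj (p.2 j) = de (de L i) l p := by
  rw [← (isWirt_de l).congr hL.openD hp fun q hq => hL.sum_gm_mul_conj hq i]
  have hc : ∀ j, ContDiffOn ℝ (⊤ : ℕ∞) (fun q : Pt n => conj (q.2 j)) D :=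
    fun j => contDiffOn_conj contDiff_snd_apply.contDiffOn
  rw [(isWirt_de l).sum _ fun j _ => hL.differentiableAt hp ((hL.smooth_gm i j).mul (hc j))]
  refine Finset.sum_congr rfl fun j _ => ?_
  rw [(isWirt_de l).mul (hL.differentiableAt hp (hL.smooth_gm i j)) (hL.differentiableAt hp (hc j)),
    de_conj, debar_snd]
  simp

theorem det_ne_zero (hL : IsCFM n D L) (hp : p ∈ D) : (gmat L p).det ≠ 0 := by
  intro h
  obtain ⟨v, hv, hv0⟩ := Matrix.exists_vecMul_eq_zero_iff.2 h
  have h1 := hL.posdef p hp v hv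
  have h2 : ∑ i, ∑ j, gm L i j p * v i * conj (v j) = 0 := by
    rw [Finset.sum_comm]
    refine Finset.sum_eq_zero fun j _ => ?_
    have h3 := congrFun hv0 j
    simp only [Matrix.vecMul, dotProduct, gmat, Pi.zero_apply] at h3
    rw [← Finset.sum_mul]
    simp only [mul_comm (gm L _ j p), h3, zero_mul]
  simp [h2] at h1

theorem sum_gi_mul_gm (hL : IsCFM n D L) (hp : p ∈ D) (l m : Fin n) :
    ∑ i, gi L l i p * gm L i m p = if l = m then 1 else 0 := by
  have h := Matrix.nonsing_inv_mul (gmat L p) (isUnit_iff_ne_zero.2 (hL.det_ne_zero hp))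
  have h2 := congrFun (congrFun h l) m
  rwa [Matrix.mul_apply, Matrix.one_apply] at h2

theorem sum_de_mul_gi (hL : IsCFM n D L) (hp : p ∈ D) (m : Fin n) :
    ∑ i, de L i p * gi L m i p = conj (p.2 m) := by
  simp only [← hL.sum_gm_mul_conj hp, Finset.sum_mul]
  rw [Finset.sum_comm]
  have : ∀ j, ∑ i, gm L i j p * conj (p.2 j) * gi L m i p =
      if m = j then conj (p.2 j) else 0 := by
    intro j
    have h := hL.sum_gi_mul_gm hp m j
    calc _ = (∑ i, gi L m i p * gm L i j p) * conj (p.2 j) := by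
          rw [Finset.sum_mul]
          exact Finset.sum_congr rfl fun i _ => by ring
      _ = _ := by rw [h]; split_ifs <;> simp
  simp [this]

theorem sum_de_mul_Cc (hL : IsCFM n D L) (hp : p ∈ D) (j l : Fin n) :
    ∑ i, de L i p * Cc L i j l p = de (de L j) l p := by
  simp only [Cc, Finset.mul_sum]
  rw [Finset.sum_comm, ← hL.sum_de_gm_mul_conj hp j l]
  refine Finset.sum_congr rfl fun m _ => ?_
  rw [← hL.sum_de_mul_gi hp m, Finset.mul_sum]
  exact Finset.sum_congr rfl fun i _ => by ring

/-- `N^i_k = L^i_{jk} η^j`. -/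
theorem Nc_eq (hL : IsCFM n D L) (hp : p ∈ D) (i k : Fin n) :
    Nc L i k p = ∑ j, Lc L i j k p * p.2 j := by
  have e : Nc L i k p = ∑ l, ∑ j, gi L l i p * dz (gm L j l) k p * p.2 j := rfl
  rw [e]
  simp only [Lc, del, Finset.sum_mul]
  conv_rhs => rw [Finset.sum_comm]
  refine Finset.sum_congr rfl fun l _ => ?_
  change _ = ∑ j, gi L l i p * (dz (gm L j l) k p -
    ∑ m, Nc L m k p * de (gm L j l) m p) * p.2 j
  have h : ∑ j, (∑ m, Nc L m k p * de (gm L j l) m p) * p.2 j = 0 := by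
    simp only [Finset.sum_mul]
    rw [Finset.sum_comm]
    refine Finset.sum_eq_zero fun m _ => ?_
    simp only [mul_assoc]
    rw [← Finset.mul_sum, hL.sum_de_gm_mul hp, mul_zero]
  have h2 : ∀ j, gi L l i p * (dz (gm L j l) k p -
      ∑ m, Nc L m k p * de (gm L j l) m p) * p.2 j = gi L l i p * dz (gm L j l) k p * p.2 j -
      gi L l i p * ((∑ m, Nc L m k p * de (gm L j l) m p) * p.2 j) := fun j => by ring
  simp only [h2, Finset.sum_sub_distrib]
  rw [← Finset.mul_sum, h, mul_zero, sub_zero]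

/-- `δ_k L = 0`. -/
theorem dz_eq (hL : IsCFM n D L) (hp : p ∈ D) (k : Fin n) :
    dz L k p = ∑ j, Nc L j k p * de L j p := by
  have hc : ∀ j, ContDiffOn ℝ (⊤ : ℕ∞) (fun q : Pt n => conj (q.2 j)) D :=
    fun j => contDiffOn_conj contDiff_snd_apply.contDiffOn
  have hz : ∀ l, ContDiffOn ℝ (⊤ : ℕ∞) (fun q : Pt n => q.2 l) D :=
    fun l => contDiff_snd_apply.contDiffOn
  have h0 : ∀ q ∈ D, ∑ l, ∑ m, gm L l m q * q.2 l * conj (q.2 m) = L q := by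
    intro q hq
    rw [← hL.euler hq]
    refine Finset.sum_congr rfl fun l _ => ?_
    rw [← hL.sum_gm_mul_conj hq, Finset.mul_sum]
    exact Finset.sum_congr rfl fun m _ => by ring
  have hs := fun l m => (((hL.smooth_gm l m).mul (hz l)).mul (hc m))
  have h1 : dz L k p = ∑ l, ∑ m, dz (gm L l m) k p * p.2 l * conj (p.2 m) := by
    rw [← (isWirt_dz k).congr hL.openD hp h0, (isWirt_dz k).sum _ fun l _ =>
      hL.differentiableAt hp (ContDiffOn.sum fun m _ => hs l m)]
    refine Finset.sum_congr rfl fun l _ => ?_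
    rw [(isWirt_dz k).sum _ fun m _ => hL.differentiableAt hp (hs l m)]
    refine Finset.sum_congr rfl fun m _ => ?_
    rw [(isWirt_dz k).mul (hL.differentiableAt hp ((hL.smooth_gm l m).mul (hz l)))
      (hL.differentiableAt hp (hc m)), (isWirt_dz k).mul (hL.differentiableAt hp (hL.smooth_gm l m))
      (hL.differentiableAt hp (hz l)), dz_conj, dzbar_snd, dz_snd]
    simp
  rw [h1, Finset.sum_comm]
  simp only [Nc, Finset.sum_mul]
  conv_rhs => rw [Finset.sum_comm]
  refine Finset.sum_congr rfl fun m _ => ?_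
  conv_rhs => rw [Finset.sum_comm]
  refine Finset.sum_congr rfl fun l _ => ?_
  rw [← hL.sum_de_mul_gi hp m, Finset.mul_sum]
  exact Finset.sum_congr rfl fun i _ => by ring

end general

variable {D : Set (Pt 2)} {L : Pt 2 → ℂ} {p : Pt 2}

theorem smooth_gi (hL : IsCFM 2 D L) (l i : Fin 2) : ContDiffOn ℝ (⊤ : ℕ∞) (gi L l i) D := by
  have hg := hL.smooth_gm
  have hdet : ContDiffOn ℝ (⊤ : ℕ∞) (fun q => (gmat L q).det) D := by
    simp only [Matrix.det_fin_two, gmat]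
    exact ((hg 0 0).mul (hg 1 1)).sub ((hg 0 1).mul (hg 1 0))
  have hinv : ContDiffOn ℝ (⊤ : ℕ∞) (fun q => ((gmat L q).det)⁻¹) D :=
    hdet.inv fun q hq => hL.det_ne_zero hq
  have hadj : ContDiffOn ℝ (⊤ : ℕ∞) (fun q => (gmat L q).adjugate l i) D := by
    simp only [Matrix.adjugate_fin_two, gmat]
    fin_cases l <;> fin_cases i <;> simp
    exacts [hg 1 1, (hg 0 1).neg, (hg 1 0).neg, hg 0 0]
  have : gi L l i = fun q => ((gmat L q).det)⁻¹ * (gmat L q).adjugate l i := by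
    funext q
    rw [gi, Matrix.inv_def, Ring.inverse_eq_inv', Matrix.smul_apply, smul_eq_mul]
  rw [this]
  exact hinv.mul hadj

theorem smooth_Nc (hL : IsCFM 2 D L) (i k : Fin 2) : ContDiffOn ℝ (⊤ : ℕ∞) (Nc L i k) D :=
  ContDiffOn.sum fun m _ => ContDiffOn.sum fun l _ =>
    ((hL.smooth_gi m i).mul ((isWirt_dz k).contDiffOn hL.openD (hL.smooth_gm l m))).mul
      contDiff_snd_apply.contDiffOn

theorem smooth_Lc (hL : IsCFM 2 D L) (i j k : Fin 2) : ContDiffOn ℝ (⊤ : ℕ∞) (Lc L i j k) D :=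
  ContDiffOn.sum fun l _ => (hL.smooth_gi l i).mul
    (((isWirt_dz k).contDiffOn hL.openD (hL.smooth_gm j l)).sub (ContDiffOn.sum fun m _ =>
      (hL.smooth_Nc m k).mul ((isWirt_de m).contDiffOn hL.openD (hL.smooth_gm j l))))

theorem smooth_dzbar_Lc (hL : IsCFM 2 D L) (h i j k : Fin 2) :
    ContDiffOn ℝ (⊤ : ℕ∞) (dzbar (Lc L i j k) h) D :=
  (isWirt_dzbar h).contDiffOn hL.openD (hL.smooth_Lc i j k)

theorem ker_de_dzbar_Lc (hL : IsCFM 2 D L) (hB : IsBerwald L D) (m h i j k : Fin 2) :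
    Ker (fun f => de f m) D (dzbar (Lc L i j k) h) where
  smooth := hL.smooth_dzbar_Lc h i j k
  eq_zero p hp := by
    rw [(isWirt_de m).comm (isWirt_dzbar h) hL.openD hp (hL.smooth_Lc i j k)]
    exact (isWirt_dzbar h).eq_zero hL.openD hp fun q hq => (hB.2 q hq i j k m).1

theorem ker_debar_dzbar_Lc (hL : IsCFM 2 D L) (hB : IsBerwald L D) (m h i j k : Fin 2) :
    Ker (fun f => debar f m) D (dzbar (Lc L i j k) h) where
  smooth := hL.smooth_dzbar_Lc h i j k
  eq_zero p hp := by
    rw [(isWirt_debar m).comm (isWirt_dzbar h) hL.openD hp (hL.smooth_Lc i j k)]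
    exact (isWirt_dzbar h).eq_zero hL.openD hp fun q hq => (hB.2 q hq i j k m).2

theorem dzbar_Lc_symm (hL : IsCFM 2 D L) (hB : IsBerwald L D) (hp : p ∈ D) (h i j k : Fin 2) :
    dzbar (Lc L i j k) h p = dzbar (Lc L i k j) h p :=
  (isWirt_dzbar h).congr hL.openD hp fun q hq => hB.1 q hq i j k

theorem debar_Nc (hL : IsCFM 2 D L) (hB : IsBerwald L D) (hp : p ∈ D) (i k m : Fin 2) :
    debar (Nc L i k) m p = 0 := by
  have hz : ∀ j, ContDiffOn ℝ (⊤ : ℕ∞) (fun q : Pt 2 => q.2 j) D :=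
    fun j => contDiff_snd_apply.contDiffOn
  rw [(isWirt_debar m).congr hL.openD hp fun q hq => hL.Nc_eq hq i k, (isWirt_debar m).sum _
    fun j _ => hL.differentiableAt hp ((hL.smooth_Lc i j k).mul (hz j))]
  refine Finset.sum_eq_zero fun j _ => ?_
  rw [(isWirt_debar m).mul (hL.differentiableAt hp (hL.smooth_Lc i j k))
    (hL.differentiableAt hp (hz j)), debar_snd, (hB.2 p hp i j k m).2]
  ring

theorem dzbar_Nc (hL : IsCFM 2 D L) (hp : p ∈ D) (i k h : Fin 2) :
    dzbar (Nc L i k) h p = ∑ j, dzbar (Lc L i j k) h p * p.2 j := by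
  have hz : ∀ j, ContDiffOn ℝ (⊤ : ℕ∞) (fun q : Pt 2 => q.2 j) D :=
    fun j => contDiff_snd_apply.contDiffOn
  rw [(isWirt_dzbar h).congr hL.openD hp fun q hq => hL.Nc_eq hq i k, (isWirt_dzbar h).sum _
    fun j _ => hL.differentiableAt hp ((hL.smooth_Lc i j k).mul (hz j))]
  refine Finset.sum_congr rfl fun j _ => ?_
  rw [(isWirt_dzbar h).mul (hL.differentiableAt hp (hL.smooth_Lc i j k))
    (hL.differentiableAt hp (hz j)), dzbar_snd]
  ring

theorem Rh_eq (hL : IsCFM 2 D L) (hB : IsBerwald L D) (hp : p ∈ D) (r j h k : Fin 2) :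
    Rh L r j h k p = ∑ i, gm L i r p * (-dzbar (Lc L i j k) h p -
      ∑ l, (∑ m, dzbar (Lc L l m k) h p * p.2 m) * Cc L i j l p) := by
  have h1 : ∀ i, delbar L (Lc L i j k) h p = dzbar (Lc L i j k) h p := by
    intro i
    simp [delbar, (hB.2 p hp i j k _).2]
  have h2 : ∀ l, delbar L (Nc L l k) h p = ∑ m, dzbar (Lc L l m k) h p * p.2 m := by
    intro l
    simp only [delbar, hL.debar_Nc hB hp, mul_zero, Finset.sum_const_zero, sub_zero,
      hL.dzbar_Nc hp]
  simp only [Rh, h1, h2]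

theorem sum_Rh_mul_conj (hL : IsCFM 2 D L) (hB : IsBerwald L D) (hp : p ∈ D) (j h k : Fin 2) :
    ∑ r, Rh L r j h k p * conj (p.2 r) = -(∑ i, de L i p * dzbar (Lc L i j k) h p) -
      ∑ l, (∑ m, dzbar (Lc L l m k) h p * p.2 m) * de (de L j) l p := by
  simp only [hL.Rh_eq hB hp, ← hL.sum_de_mul_Cc hp, ← hL.sum_gm_mul_conj hp, Fin.sum_univ_two]
  ring

/-- The hermitian symmetry coming from the vanishing of `[δ_k, δ_h̄] L`. -/
theorem sum_dzbar_Nc_mul_de (hL : IsCFM 2 D L) (hB : IsBerwald L D) (hp : p ∈ D) (h k : Fin 2) :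
    ∑ j, dzbar (Nc L j k) h p * de L j p = conj (∑ j, dzbar (Nc L j h) k p * de L j p) := by
  have key : ∀ h k, dzbar (dz L k) h p = ∑ j, dzbar (Nc L j k) h p * de L j p +
      ∑ j, ∑ m, Nc L j k p * conj (Nc L m h p) * gm L j m p := by
    intro h k
    have hc := fun m => contDiffOn_conj (hL.smooth_Nc m h)
    have h1 : ∀ j, dzbar (de L j) h p = ∑ m, conj (Nc L m h p) * gm L j m p := by
      intro j
      rw [(isWirt_dzbar h).comm (isWirt_de j) hL.openD hp hL.smooth]
      have h2 : ∀ q ∈ D, dzbar L h q = ∑ m, conj (Nc L m h q) * debar L m q := by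
        intro q hq
        simp [← hL.conj_dz hq, ← hL.conj_de hq, hL.dz_eq hq]
      rw [(isWirt_de j).congr hL.openD hp h2, (isWirt_de j).sum _
        fun m _ => hL.differentiableAt hp ((hc m).mul (hL.smooth_debar m))]
      refine Finset.sum_congr rfl fun m _ => ?_
      rw [(isWirt_de j).mul (hL.differentiableAt hp (hc m))
        (hL.differentiableAt hp (hL.smooth_debar m)), de_conj, hL.debar_Nc hB hp]
      simp [gm]
    rw [(isWirt_dzbar h).congr hL.openD hp fun q hq => hL.dz_eq hq k, (isWirt_dzbar h).sum _
      fun m _ => hL.differentiableAt hp ((hL.smooth_Nc m k).mul (hL.smooth_de m)),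
      ← Finset.sum_add_distrib]
    refine Finset.sum_congr rfl fun j _ => ?_
    rw [(isWirt_dzbar h).mul (hL.differentiableAt hp (hL.smooth_Nc j k))
        (hL.differentiableAt hp (hL.smooth_de j)), h1, Finset.mul_sum]
    simp only [mul_assoc]
  have h3 : dzbar (dz L k) h p = conj (dzbar (dz L h) k p) := by
    rw [← dz_conj, (isWirt_dzbar h).comm (isWirt_dz k) hL.openD hp hL.smooth]
    refine (isWirt_dz k).congr hL.openD hp fun q hq => ?_
    rw [← hL.conj_dz hq]
  rw [key h k, key k h, map_add] at h3
  have h4 : conj (∑ j, ∑ m, Nc L j h p * conj (Nc L m k p) * gm L j m p) =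
      ∑ j, ∑ m, Nc L j k p * conj (Nc L m h p) * gm L j m p := by
    simp only [map_sum, map_mul, Complex.conj_conj, hL.hermitian p hp]
    rw [Finset.sum_comm]
    refine Finset.sum_congr rfl fun j _ => Finset.sum_congr rfl fun m _ => ?_
    ring
  rw [h4] at h3
  exact add_right_cancel h3

theorem exists_de_de_ne_zero (hA : sA L p ≠ 0) (hL : IsCFM 2 D L) (hp : p ∈ D) :
    ∃ k l, de (de L k) l p ≠ 0 := by
  by_contra! h0
  apply hA
  have h1 : ∀ j k, ∑ h, llow L h p * Cc L h k j p = 0 := by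
    intro j k
    have h2 := hL.sum_de_mul_Cc hp k j
    rw [h0 k j] at h2
    simp only [llow, hL.sum_gm_mul_conj hp, div_mul_eq_mul_div]
    rw [← Finset.sum_div, h2, zero_div]
  refine Finset.sum_eq_zero fun j _ => Finset.sum_eq_zero fun k _ => ?_
  simp only [mul_assoc]
  rw [← Finset.mul_sum, ← Finset.mul_sum, h1, mul_zero, mul_zero]

theorem de_de_symm (hL : IsCFM 2 D L) (hp : p ∈ D) (k l : Fin 2) :
    de (de L k) l p = de (de L l) k p :=
  (isWirt_de l).comm (isWirt_de k) hL.openD hp hL.smooth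

theorem sum_wedge_eq_zero (hL : IsCFM 2 D L) (hB : IsBerwald L D) (hS : WeakSym L D)
    (hA : ∀ p ∈ D, sA L p ≠ 0) (hp : p ∈ D) :
    ∑ h, conj (p.2 h) * ((∑ m, ∑ s, dzbar (Lc L 0 m s) h p * p.2 m * p.2 s) * p.2 1 -
      (∑ m, ∑ s, dzbar (Lc L 1 m s) h p * p.2 m * p.2 s) * p.2 0) = 0 := by
  obtain ⟨k, l, hkl⟩ := hL.exists_de_de_ne_zero (hA p hp) hp
  have h1 : ∀ k, ∑ l, de (de L k) l p *
      ∑ h, conj (p.2 h) * ∑ m, ∑ s, dzbar (Lc L l m s) h p * p.2 m * p.2 s = 0 := by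
    intro k
    have h2 := hS p hp k
    have hE := fun l => hL.sum_de_de_mul hp l
    have hR : ∀ h s, ∑ r, Rh L r k h s p * conj (p.2 r) - ∑ r, Rh L r s h k p * conj (p.2 r) =
        ∑ l, (∑ m, dzbar (Lc L l m k) h p * p.2 m) * de (de L s) l p -
        ∑ l, (∑ m, dzbar (Lc L l m s) h p * p.2 m) * de (de L k) l p := by
      intro h s
      simp only [hL.sum_Rh_mul_conj hB hp, hL.dzbar_Lc_symm hB hp h _ k s]
      ring
    have h3 : ∑ h, ∑ s, conj (p.2 h) * p.2 s *
        (∑ r, Rh L r k h s p * conj (p.2 r) - ∑ r, Rh L r s h k p * conj (p.2 r)) = 0 := by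
      simp only [Fin.sum_univ_two] at h2 ⊢
      linear_combination h2
    simp only [hR] at h3
    simp only [Fin.sum_univ_two] at h3 hE ⊢
    linear_combination -h3 +
      (conj (p.2 0) * (dzbar (Lc L 0 0 k) 0 p * p.2 0 + dzbar (Lc L 0 1 k) 0 p * p.2 1) +
        conj (p.2 1) * (dzbar (Lc L 0 0 k) 1 p * p.2 0 + dzbar (Lc L 0 1 k) 1 p * p.2 1)) * hE 0 +
      (conj (p.2 0) * (dzbar (Lc L 1 0 k) 0 p * p.2 0 + dzbar (Lc L 1 1 k) 0 p * p.2 1) +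
        conj (p.2 1) * (dzbar (Lc L 1 0 k) 1 p * p.2 0 + dzbar (Lc L 1 1 k) 1 p * p.2 1)) * hE 1
  set V : Fin 2 → ℂ := fun l => ∑ h, conj (p.2 h) *
    ∑ m, ∑ s, dzbar (Lc L l m s) h p * p.2 m * p.2 s with hV
  have h3 : ∑ h, conj (p.2 h) * ((∑ m, ∑ s, dzbar (Lc L 0 m s) h p * p.2 m * p.2 s) * p.2 1 -
      (∑ m, ∑ s, dzbar (Lc L 1 m s) h p * p.2 m * p.2 s) * p.2 0) =
      V 0 * p.2 1 - V 1 * p.2 0 := by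
    simp only [hV, Fin.sum_univ_two]
    ring
  rw [h3]
  have h4 := h1 k
  have h5 := hL.sum_de_de_mul hp k
  simp only [hL.de_de_symm hp _ k] at h5
  change ∑ l, de (de L k) l p * V l = 0 at h4
  rw [Fin.sum_univ_two] at h4 h5
  refine (mul_eq_zero.1 (?_ : de (de L k) l p * _ = 0)).resolve_left hkl
  obtain rfl | rfl : l = 0 ∨ l = 1 := by fin_cases l <;> simp
  · linear_combination p.2 1 * h4 - V 1 * h5
  · linear_combination -p.2 0 * h4 + V 0 * h5

theorem wedge_eq_zero (hL : IsCFM 2 D L) (hB : IsBerwald L D) (hS : WeakSym L D)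
    (hA : ∀ p ∈ D, sA L p ≠ 0) (h : Fin 2) (hp : p ∈ D) :
    (∑ m, ∑ s, dzbar (Lc L 0 m s) h p * p.2 m * p.2 s) * p.2 1 -
      (∑ m, ∑ s, dzbar (Lc L 1 m s) h p * p.2 m * p.2 s) * p.2 0 = 0 := by
  have hz : ∀ j k, Ker (fun f => debar f k) D (fun q : Pt 2 => q.2 j) := fun j k =>
    ⟨contDiff_snd_apply.contDiffOn, fun _ _ => debar_snd⟩
  have hker : ∀ h k, Ker (fun f => debar f k) D fun q =>
      (∑ m, ∑ s, dzbar (Lc L 0 m s) h q * q.2 m * q.2 s) * q.2 1 -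
      (∑ m, ∑ s, dzbar (Lc L 1 m s) h q * q.2 m * q.2 s) * q.2 0 := by
    intro h k
    have hW := isWirt_debar (n := 2) k
    have hm : ∀ i m s, Ker (fun f => debar f k) D
        (fun q => dzbar (Lc L i m s) h q * q.2 m * q.2 s) := fun i m s =>
      ((hL.ker_debar_dzbar_Lc hB k h i m s).mul hW hL.openD (hz m k)).mul hW hL.openD (hz s k)
    have hs : ∀ i, Ker (fun f => debar f k) D
        (fun q => ∑ m, ∑ s, dzbar (Lc L i m s) h q * q.2 m * q.2 s) := by
      intro i
      simp only [Fin.sum_univ_two]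
      exact ((hm i 0 0).add hW hL.openD (hm i 0 1)).add hW hL.openD
        ((hm i 1 0).add hW hL.openD (hm i 1 1))
    exact ((hs 0).mul hW hL.openD (hz 1 k)).sub hW hL.openD ((hs 1).mul hW hL.openD (hz 0 k))
  have hc : ∀ j, ContDiffOn ℝ (⊤ : ℕ∞) (fun q : Pt 2 => conj (q.2 j)) D :=
    fun j => contDiffOn_conj contDiff_snd_apply.contDiffOn
  have hc1 : Ker (fun f => debar f 0) D (fun q : Pt 2 => conj (q.2 1)) :=
    ⟨hc 1, fun _ _ => by rw [debar_conj, de_snd]; simp⟩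
  have h0 := Ker.eq_zero_of_affine (isWirt_debar 0) hL.openD (hc 0)
    (fun _ _ => by rw [debar_conj, de_snd]; simp) (hker 0 0)
    (hc1.mul (isWirt_debar 0) hL.openD (hker 1 0)) fun q hq => by
      have := hL.sum_wedge_eq_zero hB hS hA hq
      rw [Fin.sum_univ_two] at this
      linear_combination this
  have h1 := Ker.eq_zero_of_affine (isWirt_debar 1) hL.openD (hc 1)
    (fun _ _ => by rw [debar_conj, de_snd]; simp) (hker 1 1)
    (Ker.const (isWirt_debar 1) 0) fun q hq => by
      linear_combination (h0 q hq).2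
  fin_cases h
  exacts [(h0 p hp).1, (h1 p hp).1]

/-- The curvature of the horizontal connection is projectively flat: it is determined by its
components `K^1_{0 h̄ 1}` and `K^0_{0 h̄ 1}`. -/
theorem dzbar_Lc_components (hL : IsCFM 2 D L) (hB : IsBerwald L D) (hS : WeakSym L D)
    (hA : ∀ p ∈ D, sA L p ≠ 0) (h : Fin 2) (hp : p ∈ D) :
    dzbar (Lc L 0 1 1) h p = 0 ∧ dzbar (Lc L 1 0 0) h p = 0 ∧
      dzbar (Lc L 0 0 0) h p = 2 * dzbar (Lc L 1 0 1) h p ∧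
      dzbar (Lc L 1 1 1) h p = 2 * dzbar (Lc L 0 0 1) h p := by
  have hO := hL.openD
  have hK := hL.ker_de_dzbar_Lc hB
  have hx : ∀ j, ContDiffOn ℝ (⊤ : ℕ∞) (fun q : Pt 2 => q.2 j) D :=
    fun j => contDiff_snd_apply.contDiffOn
  have hy : Ker (fun f => de f 0) D (fun q : Pt 2 => q.2 1) :=
    ⟨hx 1, fun _ _ => by rw [de_snd]; simp⟩
  have hd : ∀ j, ∀ q ∈ D, de (fun q : Pt 2 => q.2 j) j q = 1 := fun j _ _ => by
    rw [de_snd]; simp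
  have w0 := isWirt_de (n := 2) 0
  have w1 := isWirt_de (n := 2) 1
  have two : ∀ m, Ker (fun f => de f m) D (fun _ : Pt 2 => (2 : ℂ)) := fun m =>
    Ker.const (isWirt_de m) 2
  have hb := fun m => (hK m h 0 0 0).sub (isWirt_de m) hO
    ((two m).mul (isWirt_de m) hO (hK m h 1 0 1))
  have hc := fun m => ((two m).mul (isWirt_de m) hO (hK m h 0 0 1)).sub (isWirt_de m) hO
    (hK m h 1 1 1)
  have hcub := Ker.eq_zero_of_cubic w0 hO (hx 0) (hd 0) (hK 0 h 1 0 0)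
    (((Ker.const w0 (-1)).mul w0 hO (hb 0)).mul w0 hO hy)
    ((((Ker.const w0 (-1)).mul w0 hO (hc 0)).mul w0 hO hy).mul w0 hO hy)
    (((((Ker.const w0 (-1)).mul w0 hO (hK 0 h 0 1 1)).mul w0 hO hy).mul w0 hO hy).mul w0 hO hy)
    fun q hq => by
      have := hL.wedge_eq_zero hB hS hA h hq
      simp only [Fin.sum_univ_two, hL.dzbar_Lc_symm hB hq h _ 1 0] at this
      linear_combination -this
  have z := Ker.const (D := D) w1 0
  have hb0 := Ker.eq_zero_of_affine w1 hO (hx 1) (hd 1) (hb 1) z fun q hq => by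
    linear_combination -(hcub q hq).2.1
  have hc0 := Ker.eq_zero_of_quadratic w1 hO (hx 1) (hd 1) (hc 1) z z fun q hq => by
    linear_combination -(hcub q hq).2.2.1
  have hd0 := Ker.eq_zero_of_cubic w1 hO (hx 1) (hd 1) (hK 1 h 0 1 1) z z z fun q hq => by
    linear_combination -(hcub q hq).2.2.2
  refine ⟨(hd0 p hp).1, (hcub p hp).1, ?_, ?_⟩
  · linear_combination (hb0 p hp).1
  · linear_combination -(hc0 p hp).1

/-- A fibrewise constant sesquilinear form that vanishes on `D` has zero coefficients. -/
theorem sesquilinear_eq_zero (hL : IsCFM 2 D L) {c : Fin 2 → Fin 2 → Pt 2 → ℂ}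
    (hc : ∀ m h k, Ker (fun f => de f m) D (c h k))
    (hc' : ∀ m h k, Ker (fun f => debar f m) D (c h k))
    (h0 : ∀ q ∈ D, ∑ h, ∑ k, c h k q * conj (q.2 h) * q.2 k = 0) (hp : p ∈ D) (h k : Fin 2) :
    c h k p = 0 := by
  have hO := hL.openD
  have hx : ∀ j, ContDiffOn ℝ (⊤ : ℕ∞) (fun q : Pt 2 => q.2 j) D :=
    fun j => contDiff_snd_apply.contDiffOn
  have hcx : ∀ j, ContDiffOn ℝ (⊤ : ℕ∞) (fun q : Pt 2 => conj (q.2 j)) D :=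
    fun j => contDiffOn_conj (hx j)
  have hz : ∀ m j, Ker (fun f => debar f m) D (fun q : Pt 2 => q.2 j) := fun m j =>
    ⟨hx j, fun _ _ => debar_snd⟩
  have hzc : Ker (fun f => debar f 0) D (fun q : Pt 2 => conj (q.2 1)) :=
    ⟨hcx 1, fun _ _ => by rw [debar_conj, de_snd]; simp⟩
  have hy : Ker (fun f => de f 0) D (fun q : Pt 2 => q.2 1) :=
    ⟨hx 1, fun _ _ => by rw [de_snd]; simp⟩
  have hd : ∀ j, ∀ q ∈ D, de (fun q : Pt 2 => q.2 j) j q = 1 := fun j _ _ => by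
    rw [de_snd]; simp
  have hdc : ∀ j, ∀ q ∈ D, debar (fun q : Pt 2 => conj (q.2 j)) j q = 1 := fun j _ _ => by
    rw [debar_conj, de_snd]; simp
  have hrow : ∀ m h, Ker (fun f => debar f m) D (fun q => c h 0 q * q.2 0 + c h 1 q * q.2 1) :=
    fun m h => ((hc' m h 0).mul (isWirt_debar m) hO (hz m 0)).add (isWirt_debar m) hO
      ((hc' m h 1).mul (isWirt_debar m) hO (hz m 1))
  have r0 := Ker.eq_zero_of_affine (isWirt_debar 0) hO (hcx 0) (hdc 0) (hrow 0 0)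
    ((hrow 0 1).mul (isWirt_debar 0) hO hzc) fun q hq => by
      have := h0 q hq
      simp only [Fin.sum_univ_two] at this
      linear_combination this
  have r1 := Ker.eq_zero_of_affine (isWirt_debar 1) hO (hcx 1) (hdc 1) (hrow 1 1)
    (Ker.const (isWirt_debar 1) 0) fun q hq => by linear_combination (r0 q hq).2
  have hr : ∀ h, ∀ q ∈ D, c h 0 q * q.2 0 + c h 1 q * q.2 1 = 0 := by
    intro h q hq
    fin_cases h
    exacts [(r0 q hq).1, (r1 q hq).1]
  have e0 := Ker.eq_zero_of_affine (isWirt_de 0) hO (hx 0) (hd 0) (hc 0 h 0)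
    ((hc 0 h 1).mul (isWirt_de 0) hO hy) (hr h)
  have e1 := Ker.eq_zero_of_affine (isWirt_de 1) hO (hx 1) (hd 1) (hc 1 h 1)
    (Ker.const (isWirt_de 1) 0) fun q hq => by linear_combination (e0 q hq).2
  fin_cases k
  exacts [(e0 p hp).1, (e1 p hp).1]

theorem dzbar_Lc_eq_zero (hL : IsCFM 2 D L) (hB : IsBerwald L D) (hS : WeakSym L D)
    (hA : ∀ p ∈ D, sA L p ≠ 0) (hp : p ∈ D) (h i j k : Fin 2) :
    dzbar (Lc L i j k) h p = 0 := by
  have hO := hL.openD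
  obtain ⟨μ, hμ0, hμ1⟩ : ∃ μ : Fin 2 → Fin 2 → Pt 2 → ℂ,
      (∀ h, μ h 0 = dzbar (Lc L 1 0 1) h) ∧ ∀ h, μ h 1 = dzbar (Lc L 0 0 1) h :=
    ⟨fun h => ![dzbar (Lc L 1 0 1) h, dzbar (Lc L 0 0 1) h], fun _ => rfl, fun _ => rfl⟩
  have hμ : ∀ m h k, Ker (fun f => de f m) D (μ h k) := by
    intro m h k
    fin_cases k
    exacts [(hμ0 h).symm ▸ hL.ker_de_dzbar_Lc hB m h 1 0 1,
      (hμ1 h).symm ▸ hL.ker_de_dzbar_Lc hB m h 0 0 1]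
  have hμ' : ∀ m h k, Ker (fun f => debar f m) D (μ h k) := by
    intro m h k
    fin_cases k
    exacts [(hμ0 h).symm ▸ hL.ker_debar_dzbar_Lc hB m h 1 0 1,
      (hμ1 h).symm ▸ hL.ker_debar_dzbar_Lc hB m h 0 0 1]
  have hT : ∀ q ∈ D, ∀ h k, ∑ j, dzbar (Nc L j k) h q * de L j q =
      μ h k q * L q + (∑ j, μ h j q * q.2 j) * de L k q := by
    intro q hq h k
    obtain ⟨c1, c2, c3, c4⟩ := hL.dzbar_Lc_components hB hS hA h hq
    have hE := hL.euler hq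
    have hs := hL.dzbar_Lc_symm hB hq h
    simp only [hL.dzbar_Nc hq, Fin.sum_univ_two] at hE ⊢
    obtain rfl | rfl : k = 0 ∨ k = 1 := by fin_cases k <;> simp
    · rw [hs 0 1 0, hs 1 1 0, c2, c3, hμ0, hμ1, ← hE]
      ring
    · rw [c1, c4, hμ0, hμ1, ← hE]
      ring
  have hT' : ∀ q ∈ D, ∀ h k, μ h k q * L q + (∑ j, μ h j q * q.2 j) * de L k q =
      conj (μ k h q) * L q + (∑ j, conj (μ k j q) * conj (q.2 j)) * debar L h q := by
    intro q hq h k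
    rw [← hT q hq, hL.sum_dzbar_Nc_mul_de hB hq, hT q hq]
    simp only [map_add, map_mul, map_sum, hL.conj_eq hq, hL.conj_de hq]
  have hherm : ∀ q ∈ D, ∀ h k, conj (μ k h q) = μ h k q := by
    intro q hq h k
    refine sub_eq_zero.1 (hL.sesquilinear_eq_zero (c := fun h k q => conj (μ k h q) - μ h k q)
      (fun m h k => ?_) (fun m h k => ?_) (fun q hq => ?_) hq h k)
    · refine Ker.sub (isWirt_de m) hO ⟨contDiffOn_conj (hμ m k h).smooth, fun q hq => ?_⟩ (hμ m h k)
      rw [de_conj, (hμ' m k h).eq_zero q hq, map_zero]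
    · refine Ker.sub (isWirt_debar m) hO ⟨contDiffOn_conj (hμ m k h).smooth, fun q hq => ?_⟩
        (hμ' m h k)
      rw [debar_conj, (hμ m k h).eq_zero q hq, map_zero]
    · have h1 := hT' q hq
      have h2 := hL.euler hq
      have h3 := hL.euler_conj hq
      simp only [Fin.sum_univ_two] at h1 h2 h3 ⊢
      refine (mul_eq_zero.1 (?_ : L q * _ = 0)).resolve_left (hL.ne_zero hq)
      linear_combination (-1 / 2) * (conj (q.2 0) * q.2 0 * h1 0 0 + conj (q.2 0) * q.2 1 * h1 0 1 +
          conj (q.2 1) * q.2 0 * h1 1 0 + conj (q.2 1) * q.2 1 * h1 1 1) +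
        (1 / 2) * (μ 0 0 q * conj (q.2 0) * q.2 0 + μ 0 1 q * conj (q.2 0) * q.2 1 +
          μ 1 0 q * conj (q.2 1) * q.2 0 + μ 1 1 q * conj (q.2 1) * q.2 1) * h2 -
        (1 / 2) * (conj (μ 0 0 q) * conj (q.2 0) * q.2 0 + conj (μ 1 0 q) * conj (q.2 0) * q.2 1 +
          conj (μ 0 1 q) * conj (q.2 1) * q.2 0 + conj (μ 1 1 q) * conj (q.2 1) * q.2 1) * h3
  have hQ : ∀ q ∈ D, ∑ h, ∑ k, μ h k q * conj (q.2 h) * q.2 k = 0 := by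
    intro q hq
    obtain ⟨k, l, hkl⟩ := hL.exists_de_de_ne_zero (hA q hq) hq
    set ν : Fin 2 → Pt 2 → ℂ := fun k q => μ 0 k q * conj (q.2 0) + μ 1 k q * conj (q.2 1) with hν
    have hx : ∀ j, ContDiffOn ℝ (⊤ : ℕ∞) (fun q : Pt 2 => q.2 j) D :=
      fun j => contDiff_snd_apply.contDiffOn
    have hk : ∀ m j, Ker (fun f => de f m) D (fun q : Pt 2 => conj (q.2 j)) := fun m j =>
      ⟨contDiffOn_conj (hx j), fun _ _ => by rw [de_conj, debar_snd, map_zero]⟩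
    have hνk : ∀ m k, Ker (fun f => de f m) D (ν k) := fun m k =>
      ((hμ m 0 k).mul (isWirt_de m) hO (hk m 0)).add (isWirt_de m) hO
        ((hμ m 1 k).mul (isWirt_de m) hO (hk m 1))
    have hQL : ∀ q ∈ D, ∀ k, (ν 0 q * q.2 0 + ν 1 q * q.2 1) * de L k q = ν k q * L q := by
      intro q hq k
      have h1 := hT' q hq
      have h3 := hL.euler_conj hq
      simp only [hherm q hq, Fin.sum_univ_two] at h1 h3
      simp only [hν]
      linear_combination conj (q.2 0) * h1 0 k + conj (q.2 1) * h1 1 k +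
        (μ 0 k q * conj (q.2 0) + μ 1 k q * conj (q.2 1)) * h3
    have d {f} (hf : ContDiffOn ℝ (⊤ : ℕ∞) f D) := hL.differentiableAt hq hf
    have hν' : ∀ j, ContDiffOn ℝ (⊤ : ℕ∞) (ν j) D := fun j => (hνk 0 j).smooth
    have s0 := (hν' 0).mul (hx 0)
    have s1 := (hν' 1).mul (hx 1)
    have hQ' : de (fun q => ν 0 q * q.2 0 + ν 1 q * q.2 1) l q = ν l q := by
      rw [(isWirt_de l).add (d s0) (d s1), (isWirt_de l).mul (d (hν' 0)) (d (hx 0)),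
        (isWirt_de l).mul (d (hν' 1)) (d (hx 1)), (hνk l 0).eq_zero q hq, (hνk l 1).eq_zero q hq,
        de_snd, de_snd]
      obtain rfl | rfl : l = 0 ∨ l = 1 := by fin_cases l <;> simp
      all_goals simp
    have hd := (isWirt_de l).congr hO hq fun q hq => hQL q hq k
    rw [(isWirt_de l).mul (d (s0.add s1)) (d (hL.smooth_de k)), hQ',
      (isWirt_de l).mul (d (hν' k)) (d hL.smooth), (hνk l k).eq_zero q hq] at hd
    have hsq : (ν 0 q * q.2 0 + ν 1 q * q.2 1) ^ 2 * de (de L k) l q = 0 := by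
      linear_combination (ν 0 q * q.2 0 + ν 1 q * q.2 1) * hd - ν l q * hQL q hq k +
        ν k q * hQL q hq l
    have := pow_eq_zero_iff two_ne_zero |>.1 ((mul_eq_zero.1 hsq).resolve_right hkl)
    simp only [Fin.sum_univ_two]
    linear_combination this
  have hμz := fun h k => hL.sesquilinear_eq_zero hμ hμ' hQ hp h k
  obtain ⟨c1, c2, c3, c4⟩ := hL.dzbar_Lc_components hB hS hA h hp
  have z0 := hμz h 0
  have z1 := hμz h 1
  rw [hμ0] at z0
  rw [hμ1] at z1
  have hs := hL.dzbar_Lc_symm hB hp h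
  fin_cases i <;> fin_cases j <;> fin_cases k <;> simp [c1, c2, c3, c4, z0, z1, hs _ 1 0]

end IsCFM

/-- a connected complex Berwald metric with the weak symmetry condition
and `A` nowhere zero has vanishing `h h̄`-Riemann type tensor. -/
theorem statement17 (D : Set (Pt 2)) (L : Pt 2 → ℂ) (hL : IsCFM 2 D L)
    (hconn : IsConnected D) (hBer : IsBerwald L D) (hsym : WeakSym L D)
    (hA : ∀ p ∈ D, sA L p ≠ 0) :
    ∀ p ∈ D, ∀ r j h k : Fin 2, Rh L r j h k p = 0 := by
  intro p hp r j h k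
  simp [hL.Rh_eq hBer hp, hL.dzbar_Lc_eq_zero hBer hsym hA hp]

end CFinsler
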